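/- Let U ⊆ ℝⁿ be open and let ∇ be a torsion-free affine connection on U with curvature R_{ab}^c_d, and assume ∇_a R_{bc}^d_e = 0 on U. If σ_b is a smooth 1-form on U with ∇_a σ_b + ∇_b σ_a = 0 (a Killing 1-form), then the 2-form μ_{ab} := ∇_a σ_b satisfies μ(x) ∈ K_x for every x ∈ U; explicitly, R_{ab}^e_c μ_{de} − R_{ab}^e_d μ_{ce} + R_{cd}^e_a μ_{be} − R_{cd}^e_b μ_{ae} = 0 holds everywhere on U for all indices a, b, c, d. -/

import Mathlib

open scoped BigOperators

noncomputable section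

/-- Partial derivative in coordinate direction `a`. -/
def pd {n : ℕ} (a : Fin n) (f : (Fin n → ℝ) → ℝ) (x : Fin n → ℝ) : ℝ :=
  fderiv ℝ f x (Pi.single a 1)

/-- Curvature `R_{ab}ᶜ_d` of the affine connection with Christoffel symbols `Γ`. -/
def curv {n : ℕ} (Γ : Fin n → Fin n → Fin n → (Fin n → ℝ) → ℝ)
    (a b c d : Fin n) (x : Fin n → ℝ) : ℝ :=
  pd a (Γ b d c) x - pd b (Γ a d c) x +
    ∑ e, (Γ b d e x * Γ a e c x - Γ a d e x * Γ b e c x)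

/-- Covariant derivative `∇_a R_{bc}ᵈ_e` of the curvature. -/
def covR {n : ℕ} (Γ : Fin n → Fin n → Fin n → (Fin n → ℝ) → ℝ)
    (a b c d e : Fin n) (x : Fin n → ℝ) : ℝ :=
  pd a (curv Γ b c d e) x - ∑ f, Γ a b f x * curv Γ f c d e x
    - ∑ f, Γ a c f x * curv Γ b f d e x + ∑ f, Γ a f d x * curv Γ b c f e x
    - ∑ f, Γ a e f x * curv Γ b c d f x

/-- Membership of an antisymmetric bilinear form `m` in the space `K_x`. -/
def Kmem {n : ℕ} (Γ : Fin n → Fin n → Fin n → (Fin n → ℝ) → ℝ)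
    (x : Fin n → ℝ) (m : Fin n → Fin n → ℝ) : Prop :=
  (∀ b c, m b c = - m c b) ∧
  ∀ a b c d, ∑ e, (curv Γ a b e c x * m d e - curv Γ a b e d x * m c e
    + curv Γ c d e a x * m b e - curv Γ c d e b x * m a e) = 0

/-- Covariant derivative `∇_a σ_b` of a 1-form. -/
def cov1 {n : ℕ} (Γ : Fin n → Fin n → Fin n → (Fin n → ℝ) → ℝ)
    (a : Fin n) (σ : Fin n → (Fin n → ℝ) → ℝ) (b : Fin n) (x : Fin n → ℝ) : ℝ :=
  pd a (σ b) x - ∑ e, Γ a b e x * σ e x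

section PartialDerivatives

variable {n : ℕ} {U : Set (Fin n → ℝ)} {x : Fin n → ℝ} {f g : (Fin n → ℝ) → ℝ}

theorem ContDiffOn.differentiableAt_of_isOpen (hf : ContDiffOn ℝ (⊤ : ℕ∞) f U) (hU : IsOpen U)
    (hx : x ∈ U) : DifferentiableAt ℝ f x :=
  (hf.contDiffAt (hU.mem_nhds hx)).differentiableAt (by simp)

theorem pd_sub (a : Fin n) (hf : DifferentiableAt ℝ f x) (hg : DifferentiableAt ℝ g x) :
    pd a (fun y => f y - g y) x = pd a f x - pd a g x := by
  simp [pd, fderiv_fun_sub hf hg]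

theorem pd_add (a : Fin n) (hf : DifferentiableAt ℝ f x) (hg : DifferentiableAt ℝ g x) :
    pd a (fun y => f y + g y) x = pd a f x + pd a g x := by
  simp [pd, fderiv_fun_add hf hg]

theorem pd_neg (a : Fin n) (f : (Fin n → ℝ) → ℝ) (x : Fin n → ℝ) :
    pd a (fun y => -f y) x = -pd a f x := by
  simp [pd, fderiv_fun_neg]

theorem pd_sum_mul {ι : Type*} [Fintype ι] {F G : ι → (Fin n → ℝ) → ℝ} (a : Fin n)
    (hF : ∀ i, DifferentiableAt ℝ (F i) x) (hG : ∀ i, DifferentiableAt ℝ (G i) x) :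
    pd a (fun y => ∑ i, F i y * G i y) x
      = ∑ i, (pd a (F i) x * G i x + F i x * pd a (G i) x) := by
  simp only [pd]
  rw [fderiv_fun_sum fun i _ => (hF i).fun_mul (hG i), sum_apply]
  refine Finset.sum_congr rfl fun i _ => ?_
  rw [fderiv_fun_mul (hF i) (hG i)]
  simp only [add_apply, smul_apply, smul_eq_mul]
  ring

theorem pd_congr (a : Fin n) (hU : IsOpen U) (hx : x ∈ U) (h : ∀ y ∈ U, f y = g y) :
    pd a f x = pd a g x := by
  simp only [pd]
  rw [Filter.EventuallyEq.fderiv_eq (Filter.eventually_of_mem (hU.mem_nhds hx) h)]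

theorem ContDiffOn.pd (hf : ContDiffOn ℝ (⊤ : ℕ∞) f U) (hU : IsOpen U) (a : Fin n) :
    ContDiffOn ℝ (⊤ : ℕ∞) (pd a f) U :=
  (hf.fderiv_of_isOpen hU (by simp)).clm_apply contDiffOn_const

theorem pd_comm (hf : ContDiffOn ℝ (⊤ : ℕ∞) f U) (hU : IsOpen U) (hx : x ∈ U) (a b : Fin n) :
    pd a (pd b f) x = pd b (pd a f) x := by
  have hd : DifferentiableAt ℝ (fderiv ℝ f) x :=
    ((hf.fderiv_of_isOpen (m := (⊤ : ℕ∞)) hU (by simp)).contDiffAt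
      (hU.mem_nhds hx)).differentiableAt (by simp)
  have key : ∀ v w : Fin n → ℝ,
      fderiv ℝ (fun y => fderiv ℝ f y v) x w = fderiv ℝ (fderiv ℝ f) x w v := by
    intro v w
    rw [fderiv_clm_apply hd (differentiableAt_const v)]
    simp
  have hs : IsSymmSndFDerivAt ℝ f x :=
    (hf.contDiffAt (hU.mem_nhds hx)).isSymmSndFDerivAt
      (by simpa using WithTop.coe_le_coe.2 (le_top : (2 : ℕ∞) ≤ ⊤))
  exact (key _ _).trans ((hs.eq _ _).trans (key _ _).symm)

end PartialDerivatives

section Connection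

variable {n : ℕ} {U : Set (Fin n → ℝ)} {Γ : Fin n → Fin n → Fin n → (Fin n → ℝ) → ℝ}
  {σ : Fin n → (Fin n → ℝ) → ℝ} {x : Fin n → ℝ}

theorem contDiffOn_curv (hU : IsOpen U) (hΓ : ∀ a b c, ContDiffOn ℝ (⊤ : ℕ∞) (Γ a b c) U)
    (a b c d : Fin n) : ContDiffOn ℝ (⊤ : ℕ∞) (curv Γ a b c d) U :=
  (((hΓ b d c).pd hU a).sub ((hΓ a d c).pd hU b)).add <| ContDiffOn.sum fun e _ =>
    ((hΓ b d e).mul (hΓ a e c)).sub ((hΓ a d e).mul (hΓ b e c))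

theorem contDiffOn_cov1 (hU : IsOpen U) (hΓ : ∀ a b c, ContDiffOn ℝ (⊤ : ℕ∞) (Γ a b c) U)
    (hσ : ∀ b, ContDiffOn ℝ (⊤ : ℕ∞) (σ b) U) (a b : Fin n) :
    ContDiffOn ℝ (⊤ : ℕ∞) (cov1 Γ a σ b) U :=
  ((hσ b).pd hU a).sub <| ContDiffOn.sum fun e _ => (hΓ a b e).mul (hσ e)

theorem curv_antisymm (Γ : Fin n → Fin n → Fin n → (Fin n → ℝ) → ℝ) (a b c d : Fin n)
    (x : Fin n → ℝ) : curv Γ a b c d x = -curv Γ b a c d x := by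
  simp only [curv, Finset.sum_sub_distrib]
  ring

/-- The algebraic Bianchi identity of a torsion-free connection. -/
theorem curv_bianchi (hU : IsOpen U) (hsym : ∀ a b c, ∀ x ∈ U, Γ a b c x = Γ b a c x)
    (hx : x ∈ U) (a b c d : Fin n) :
    curv Γ a b d c x + curv Γ b c d a x + curv Γ c a d b x = 0 := by
  have hp : ∀ e p q r, pd e (Γ p q r) x = pd e (Γ q p r) x := fun e p q r =>
    pd_congr e hU hx (hsym p q r)
  simp only [curv, Finset.sum_sub_distrib]
  rw [hp a c b, hp b a c, hp c b a]
  have hs : ∀ p q r, ∑ e, Γ p q e x * Γ r e d x = ∑ e, Γ q p e x * Γ r e d x :=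
    fun p q r => Finset.sum_congr rfl fun e _ => by rw [hsym p q e x hx]
  rw [hs c b a, hs a c b, hs b a c]
  ring

/-- The Ricci identity for a 1-form, without the torsion terms. -/
theorem pd_cov1_sub_pd_cov1 (hU : IsOpen U)
    (hΓ : ∀ a b c, ContDiffOn ℝ (⊤ : ℕ∞) (Γ a b c) U)
    (hσ : ∀ b, ContDiffOn ℝ (⊤ : ℕ∞) (σ b) U) (hx : x ∈ U) (a b c : Fin n) :
    pd a (cov1 Γ b σ c) x - pd b (cov1 Γ a σ c) x
      - ∑ e, Γ a c e x * cov1 Γ b σ e x + ∑ e, Γ b c e x * cov1 Γ a σ e x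
      = -∑ e, curv Γ a b e c x * σ e x := by
  have hd : ∀ p q, pd p (cov1 Γ q σ c) x = pd p (pd q (σ c)) x
      - ∑ e, (pd p (Γ q c e) x * σ e x
        + Γ q c e x * (cov1 Γ p σ e x + ∑ f, Γ p e f x * σ f x)) := by
    intro p q
    have h := pd_sub p (((hσ c).pd hU q).differentiableAt_of_isOpen hU hx)
      ((ContDiffOn.sum (s := Finset.univ) fun e _ =>
        (hΓ q c e).mul (hσ e)).differentiableAt_of_isOpen hU hx)
    refine h.trans ?_
    rw [pd_sum_mul p (fun e => (hΓ q c e).differentiableAt_of_isOpen hU hx)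
      (fun e => (hσ e).differentiableAt_of_isOpen hU hx)]
    simp [cov1]
  have hswap : ∀ p q, ∑ e, Γ q c e x * ∑ f, Γ p e f x * σ f x
      = ∑ e, (∑ f, Γ q c f x * Γ p f e x) * σ e x := by
    intro p q
    simp only [Finset.mul_sum, Finset.sum_mul]
    rw [Finset.sum_comm]
    simp only [mul_assoc]
  rw [hd a b, hd b a, pd_comm (hσ c) hU hx a b]
  simp only [mul_add, Finset.sum_add_distrib, hswap, curv, Finset.sum_sub_distrib, add_mul,
    sub_mul]
  ring

/-- Prolongation of the Killing equation: `∇_c μ_{ab} = R_{ab}ᵈ_c σ_d`. -/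
theorem pd_cov1_of_killing (hU : IsOpen U)
    (hΓ : ∀ a b c, ContDiffOn ℝ (⊤ : ℕ∞) (Γ a b c) U)
    (hsym : ∀ a b c, ∀ x ∈ U, Γ a b c x = Γ b a c x)
    (hσ : ∀ b, ContDiffOn ℝ (⊤ : ℕ∞) (σ b) U)
    (hK : ∀ a b, ∀ x ∈ U, cov1 Γ a σ b x + cov1 Γ b σ a x = 0)
    (a b c : Fin n) (hx : x ∈ U) :
    pd c (cov1 Γ a σ b) x = ∑ e, curv Γ a b e c x * σ e x
      + ∑ e, Γ c a e x * cov1 Γ e σ b x + ∑ e, cov1 Γ a σ e x * Γ c b e x := by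
  have hE := pd_cov1_sub_pd_cov1 hU hΓ hσ hx
  have hp : ∀ p q r, pd p (cov1 Γ q σ r) x = -pd p (cov1 Γ r σ q) x := by
    intro p q r
    rw [← pd_neg]
    exact pd_congr p hU hx fun y hy => by linarith [hK q r y hy]
  have hG : ∀ p q r, ∑ e, Γ p q e x * cov1 Γ r σ e x = ∑ e, Γ q p e x * cov1 Γ r σ e x :=
    fun p q r => Finset.sum_congr rfl fun e _ => by rw [hsym p q e x hx]
  have hμ : ∑ e, Γ c a e x * cov1 Γ e σ b x = -∑ e, Γ c a e x * cov1 Γ b σ e x := by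
    rw [← Finset.sum_neg_distrib]
    refine Finset.sum_congr rfl fun e _ => ?_
    rw [show cov1 Γ e σ b x = -cov1 Γ b σ e x by linarith [hK e b x hx]]
    ring
  have hν : ∑ e, cov1 Γ a σ e x * Γ c b e x = ∑ e, Γ c b e x * cov1 Γ a σ e x := by
    simp only [mul_comm]
  have hB : ∑ e, curv Γ a b e c x * σ e x + ∑ e, curv Γ b c e a x * σ e x
      + ∑ e, curv Γ c a e b x * σ e x = 0 := by
    simp only [← Finset.sum_add_distrib, ← add_mul, curv_bianchi hU hsym hx, zero_mul,
      Finset.sum_const_zero]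
  rw [hμ, hν]
  linarith [hE a b c, hE b c a, hE c a b, hp a b c, hp b c a, hp c a b,
    hG a b c, hG b c a, hG c a b]

/-- The derivative of `R_{ab}ᵉ_c σ_e` when the curvature is parallel. -/
theorem pd_sum_curv_mul (hU : IsOpen U)
    (hΓ : ∀ a b c, ContDiffOn ℝ (⊤ : ℕ∞) (Γ a b c) U)
    (hσ : ∀ b, ContDiffOn ℝ (⊤ : ℕ∞) (σ b) U) (hx : x ∈ U)
    (hloc : ∀ a b c d e, covR Γ a b c d e x = 0) (a b c d : Fin n) :
    pd d (fun y => ∑ e, curv Γ a b e c y * σ e y) x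
      = ∑ f, Γ d a f x * (∑ e, curv Γ f b e c x * σ e x)
        + ∑ f, (∑ e, curv Γ a f e c x * σ e x) * Γ d b f x
        + ∑ f, Γ d c f x * (∑ e, curv Γ a b e f x * σ e x)
        + ∑ e, curv Γ a b e c x * cov1 Γ d σ e x := by
  rw [pd_sum_mul d (fun e => (contDiffOn_curv hU hΓ a b e c).differentiableAt_of_isOpen hU hx)
      (fun e => (hσ e).differentiableAt_of_isOpen hU hx)]
  have hR : ∀ e, pd d (curv Γ a b e c) x = ∑ f, Γ d a f x * curv Γ f b e c x
      + ∑ f, Γ d b f x * curv Γ a f e c x - ∑ f, Γ d f e x * curv Γ a b f c x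
      + ∑ f, Γ d c f x * curv Γ a b e f x := by
    intro e
    have h := hloc d a b e c
    simp only [covR] at h
    linarith
  have hS : ∀ e, pd d (σ e) x = cov1 Γ d σ e x + ∑ f, Γ d e f x * σ f x := by
    intro e
    simp [cov1]
  have h1 : ∀ (g : Fin n → ℝ) (k : Fin n → Fin n → ℝ),
      ∑ f, g f * ∑ e, k f e * σ e x = ∑ e, (∑ f, g f * k f e) * σ e x := by
    intro g k
    simp only [Finset.mul_sum, Finset.sum_mul]
    rw [Finset.sum_comm]
    simp only [mul_assoc]
  have h2 : ∑ e, curv Γ a b e c x * ∑ f, Γ d e f x * σ f x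
      = ∑ e, (∑ f, Γ d f e x * curv Γ a b f c x) * σ e x := by
    rw [h1]
    simp only [mul_comm]
  have h3 : ∑ f, (∑ e, curv Γ a f e c x * σ e x) * Γ d b f x
      = ∑ f, Γ d b f x * ∑ e, curv Γ a f e c x * σ e x := by
    simp only [mul_comm]
  rw [h3]
  simp only [hR, hS, h1, mul_add, add_mul, sub_mul, Finset.sum_add_distrib,
    Finset.sum_sub_distrib]
  rw [← h1, ← h1, ← h1, ← h2]
  simp only [h1]
  ring

end Connection

/-- **The derivative of a Killing 1-form lies in `K`.**
If `∇` is affine locally symmetric and `σ` is a Killing 1-form, then the 2-form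
`μ_{ab} := ∇_a σ_b` satisfies `μ(x) ∈ K_x` for every `x ∈ U`; in particular
`R_{ab}ᵉ_c μ_{de} − R_{ab}ᵉ_d μ_{ce} + R_{cd}ᵉ_a μ_{be} − R_{cd}ᵉ_b μ_{ae} = 0` on `U`. -/
theorem killing_one_form_derivative_in_K
    {n : ℕ} (hn : 1 ≤ n) (U : Set (Fin n → ℝ)) (hU : IsOpen U)
    (Γ : Fin n → Fin n → Fin n → (Fin n → ℝ) → ℝ)
    (hΓsmooth : ∀ a b c, ContDiffOn ℝ (⊤ : ℕ∞) (Γ a b c) U)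
    (hΓsym : ∀ a b c, ∀ x ∈ U, Γ a b c x = Γ b a c x)
    (hlocsym : ∀ a b c d e, ∀ x ∈ U, covR Γ a b c d e x = 0)
    (σ : Fin n → (Fin n → ℝ) → ℝ)
    (hσsmooth : ∀ b, ContDiffOn ℝ (⊤ : ℕ∞) (σ b) U)
    (hKilling : ∀ a b, ∀ x ∈ U, cov1 Γ a σ b x + cov1 Γ b σ a x = 0) :
    ∀ x ∈ U, Kmem Γ x (fun a b => cov1 Γ a σ b x) := by
  intro x hx
  refine ⟨fun b c => by linarith [hKilling b c x hx], fun a b c d => ?_⟩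
  have hμ := contDiffOn_cov1 hU hΓsmooth hσsmooth
  have hR := contDiffOn_curv hU hΓsmooth
  have hpd := fun p q r y (hy : y ∈ U) =>
    pd_cov1_of_killing hU hΓsmooth hΓsym hσsmooth hKilling p q r hy
  let A : Fin n → Matrix (Fin n) (Fin n) ℝ := fun p => .of fun q r => Γ p q r x
  let B : Fin n → Fin n → Matrix (Fin n) (Fin n) ℝ :=
    fun s p => .of fun q r => pd s (Γ p q r) x
  let F : Fin n → Fin n → Matrix (Fin n) (Fin n) ℝ :=
    fun s p => .of fun q r => curv Γ s p r q x
  let m : Matrix (Fin n) (Fin n) ℝ := .of fun p q => cov1 Γ p σ q x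
  let M : Fin n → Matrix (Fin n) (Fin n) ℝ :=
    fun r => .of fun p q => ∑ e, curv Γ p q e r x * σ e x
  let C : Fin n → Fin n → Matrix (Fin n) (Fin n) ℝ :=
    fun s r => .of fun p q => ∑ f, Γ s r f x * (∑ e, curv Γ p q e f x * σ e x)
  let L : Fin n → Fin n → Matrix (Fin n) (Fin n) ℝ :=
    fun s r => .of fun p q => ∑ e, curv Γ p q e r x * cov1 Γ s σ e x
  let D : Fin n → Matrix (Fin n) (Fin n) ℝ := fun s => .of fun p q => pd s (cov1 Γ p σ q) x
  let P : Fin n → Fin n → Matrix (Fin n) (Fin n) ℝ :=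
    fun s r => .of fun p q => pd s (pd r (cov1 Γ p σ q)) x
  have hD : ∀ s, D s = M s + A s * m + m * (A s).transpose := by
    intro s
    ext p q
    simpa [D, M, A, m, Matrix.mul_apply] using hpd p q s x hx
  have hF : ∀ s r, F s r = B s r - B r s + (A r * A s - A s * A r) := by
    intro s r
    ext p q
    simp [F, B, A, curv, Matrix.mul_apply]
  have hP : ∀ s r, P s r = (A s * M r + M r * (A s).transpose + C s r + L s r)
      + (B s r * m + A r * D s) + (D s * (A r).transpose + m * (B s r).transpose) := by
    intro s r
    ext p q
    have hΓd := fun i j k => (hΓsmooth i j k).differentiableAt_of_isOpen hU hx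
    have hμd := fun i j => (hμ i j).differentiableAt_of_isOpen hU hx
    have h1 := (ContDiffOn.sum (s := Finset.univ) fun e _ =>
      (hR p q e r).mul (hσsmooth e)).differentiableAt_of_isOpen hU hx
    have h2 := (ContDiffOn.sum (s := Finset.univ) fun e _ =>
      (hΓsmooth r p e).mul (hμ e q)).differentiableAt_of_isOpen hU hx
    have h3 := (ContDiffOn.sum (s := Finset.univ) fun e _ =>
      (hμ p e).mul (hΓsmooth r q e)).differentiableAt_of_isOpen hU hx
    have h := pd_congr s hU hx (hpd p q r)
    rw [pd_add s (h1.fun_add h2) h3, pd_add s h1 h2,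
      pd_sum_curv_mul hU hΓsmooth hσsmooth hx (fun _ _ _ _ _ => hlocsym _ _ _ _ _ x hx),
      pd_sum_mul s (fun e => hΓd r p e) (fun e => hμd e q),
      pd_sum_mul s (fun e => hμd p e) (fun e => hΓd r q e)] at h
    simpa [P, A, M, C, L, B, D, m, Matrix.mul_apply, Finset.sum_add_distrib] using h
  have hPs : P d c = P c d := by
    ext p q
    exact pd_comm (hμ p q) hU hx d c
  have hC : C d c = C c d := by
    ext p q
    simp only [C, Matrix.of_apply, hΓsym d c _ x hx]
  have key : L d c - L c d + F d c * m + m * (F d c).transpose = 0 := by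
    rw [← sub_eq_zero, hP d c, hP c d, hC, hD d, hD c] at hPs
    rw [hF, ← hPs]
    simp only [Matrix.transpose_add, Matrix.transpose_sub, Matrix.transpose_mul]
    noncomm_ring
  have hab := congrFun (congrFun key a) b
  simp only [Matrix.add_apply, Matrix.sub_apply, Matrix.mul_apply, Matrix.transpose_apply,
    Matrix.of_apply, Matrix.zero_apply, L, F, m, ← Finset.sum_add_distrib,
    ← Finset.sum_sub_distrib] at hab
  rw [← hab]
  refine Finset.sum_congr rfl fun e _ => ?_
  rw [curv_antisymm Γ d c e a x, curv_antisymm Γ d c e b x,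
    show cov1 Γ e σ b x = -cov1 Γ b σ e x by linarith [hKilling e b x hx]]
  ring

end
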